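/- arXiv:2410.01616 — 3 statements merged into one kernel-verified Lean document; each statement's English description precedes it below -/
import Mathlib

section
/- Let g be a C¹ metric on U and V = (V_μ) a C² covector field on U satisfying the relativistic Euler equation V^μ∇_μ V_ν + (1/2)∂_ν‖V‖² = 0 on U. Then the vorticity ω_{μν} := ∂_μ V_ν − ∂_ν V_μ satisfies the transport equation ∇_V ω_{μν} + (∇_μ V^λ)ω_{λν} + (∇_ν V^λ)ω_{μλ} = 0 on U (i.e. the Lie derivative of ω along V vanishes). -/
noncomputable section

/-- Points of spacetime: coordinates (x⁰,x¹,x²,x³). -/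
abbrev Vec4 : Type := Fin 4 → ℝ

/-- Partial derivative ∂_μ f. -/
def pd (μ : Fin 4) (f : Vec4 → ℝ) (x : Vec4) : ℝ := fderiv ℝ f x (Pi.single μ 1)

/-- Christoffel symbols Γ^l_{μν} of the metric g, with pointwise inverse ginv. -/
def Chris (g ginv : Vec4 → Fin 4 → Fin 4 → ℝ) (l μ ν : Fin 4) (x : Vec4) : ℝ :=
  (1 / 2) * ∑ κ, ginv x l κ *
    (pd μ (fun y => g y κ ν) x + pd ν (fun y => g y κ μ) x - pd κ (fun y => g y μ ν) x)

/-- Raised index V^μ := g^{μν} V_ν. -/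
def Vup (ginv : Vec4 → Fin 4 → Fin 4 → ℝ) (V : Vec4 → Fin 4 → ℝ) (μ : Fin 4) (x : Vec4) : ℝ :=
  ∑ ν, ginv x μ ν * V x ν

/-- ‖V‖² := −g^{μν} V_μ V_ν. -/
def normSq (ginv : Vec4 → Fin 4 → Fin 4 → ℝ) (V : Vec4 → Fin 4 → ℝ) (x : Vec4) : ℝ :=
  -∑ μ, ∑ ν, ginv x μ ν * V x μ * V x ν

/-- Vorticity two-form ω_{μν} := ∂_μ V_ν − ∂_ν V_μ. -/
def vort (V : Vec4 → Fin 4 → ℝ) (μ ν : Fin 4) (x : Vec4) : ℝ :=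
  pd μ (fun y => V y ν) x - pd ν (fun y => V y μ) x

/-- Covariant derivative of a covector: ∇_μ V_ν := ∂_μ V_ν − Γ^κ_{μν} V_κ. -/
def covD (g ginv : Vec4 → Fin 4 → Fin 4 → ℝ) (V : Vec4 → Fin 4 → ℝ) (μ ν : Fin 4) (x : Vec4) : ℝ :=
  pd μ (fun y => V y ν) x - ∑ κ, Chris g ginv κ μ ν x * V x κ

/-- Covariant derivative of the raised velocity: ∇_μ V^l := ∂_μ V^l + Γ^l_{μκ} V^κ. -/
def covDup (g ginv : Vec4 → Fin 4 → Fin 4 → ℝ) (V : Vec4 → Fin 4 → ℝ) (μ l : Fin 4) (x : Vec4) : ℝ :=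
  pd μ (fun y => Vup ginv V l y) x + ∑ κ, Chris g ginv l μ κ x * Vup ginv V κ x

/-- Covariant derivative of the vorticity two-form:
∇_l ω_{μν} := ∂_l ω_{μν} − Γ^κ_{lμ} ω_{κν} − Γ^κ_{lν} ω_{μκ}. -/
def covVort (g ginv : Vec4 → Fin 4 → Fin 4 → ℝ) (V : Vec4 → Fin 4 → ℝ) (l μ ν : Fin 4) (x : Vec4) : ℝ :=
  pd l (fun y => vort V μ ν y) x - (∑ κ, Chris g ginv κ l μ x * vort V κ ν x)
    - ∑ κ, Chris g ginv κ l ν x * vort V μ κ x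

lemma pd_congr {U : Set Vec4} (hU : IsOpen U) {f h : Vec4 → ℝ} (hfh : ∀ y ∈ U, f y = h y)
    {x : Vec4} (hx : x ∈ U) (μ : Fin 4) : pd μ f x = pd μ h x := by
  unfold pd
  have : f =ᶠ[nhds x] h := by
    filter_upwards [hU.mem_nhds hx] with y hy using hfh y hy
  rw [this.fderiv_eq]

lemma pd_sum_mul {x : Vec4} (μ : Fin 4) (a b : Fin 4 → Vec4 → ℝ)
    (ha : ∀ l, DifferentiableAt ℝ (a l) x) (hb : ∀ l, DifferentiableAt ℝ (b l) x) :
    pd μ (fun y => ∑ l, a l y * b l y) x = ∑ l, (pd μ (a l) x * b l x + a l x * pd μ (b l) x) := by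
  unfold pd
  rw [fderiv_fun_sum (fun l _ => (ha l).fun_mul (hb l))]
  simp only [ContinuousLinearMap.sum_apply]
  refine Finset.sum_congr rfl fun l _ => ?_
  rw [fderiv_fun_mul (ha l) (hb l)]
  simp
  ring

lemma pd_sub' {x : Vec4} (μ : Fin 4) (a b : Vec4 → ℝ)
    (ha : DifferentiableAt ℝ a x) (hb : DifferentiableAt ℝ b x) :
    pd μ (fun y => a y - b y) x = pd μ a x - pd μ b x := by
  unfold pd
  rw [fderiv_fun_sub ha hb]
  simp

lemma pd_neg' {x : Vec4} (μ : Fin 4) (a : Vec4 → ℝ) :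
    pd μ (fun y => - a y) x = - pd μ a x := by
  unfold pd
  rw [fderiv_fun_neg]
  simp

lemma pd_diff {x : Vec4} (μ : Fin 4) (f : Vec4 → ℝ) (hf : ContDiffAt ℝ 2 f x) :
    DifferentiableAt ℝ (pd μ f) x := by
  have h : DifferentiableAt ℝ (fderiv ℝ f) x :=
    (hf.fderiv_right (m := 1) (by norm_num)).differentiableAt (by norm_num)
  unfold pd
  exact h.clm_apply (differentiableAt_const _)

lemma pd_comm {x : Vec4} (μ ν : Fin 4) (f : Vec4 → ℝ) (hf : ContDiffAt ℝ 2 f x) :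
    pd μ (pd ν f) x = pd ν (pd μ f) x := by
  have h : DifferentiableAt ℝ (fderiv ℝ f) x :=
    (hf.fderiv_right (m := 1) (by norm_num)).differentiableAt (by norm_num)
  have key : ∀ α β : Fin 4, pd α (pd β f) x
      = fderiv ℝ (fderiv ℝ f) x (Pi.single α 1) (Pi.single β 1) := by
    intro α β
    have e : pd β f = fun y => fderiv ℝ f y (Pi.single β 1) := rfl
    rw [e]
    unfold pd
    rw [fderiv_clm_apply h (differentiableAt_const _)]
    simp
  rw [key, key]
  exact (hf.isSymmSndFDerivAt (by simp)).eq _ _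

lemma det_diff {x : Vec4} (M : Vec4 → Matrix (Fin 4) (Fin 4) ℝ)
    (hM : ∀ i j, DifferentiableAt ℝ (fun y => M y i j) x) :
    DifferentiableAt ℝ (fun y => (M y).det) x := by
  simp only [Matrix.det_apply']
  refine DifferentiableAt.fun_sum fun σ _ => ?_
  refine (differentiableAt_const _).fun_mul ?_
  simp only [Fin.prod_univ_four]
  exact (((hM _ _).fun_mul (hM _ _)).fun_mul (hM _ _)).fun_mul (hM _ _)

lemma ginv_diff {U : Set Vec4} (hU : IsOpen U) (g ginv : Vec4 → Fin 4 → Fin 4 → ℝ)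
    (hinv : ∀ x ∈ U, ∀ μ ν, (∑ κ, g x μ κ * ginv x κ ν) = if μ = ν then 1 else 0)
    {x : Vec4} (hx : x ∈ U) (hg : ∀ μ ν, DifferentiableAt ℝ (fun y => g y μ ν) x) (i j : Fin 4) :
    DifferentiableAt ℝ (fun y => ginv y i j) x := by
  have hm : ∀ y ∈ U, (Matrix.of (g y)) * (Matrix.of (ginv y)) = 1 := by
    intro y hy
    ext a b
    rw [Matrix.mul_apply, Matrix.one_apply]
    exact hinv y hy a b
  have hdet : (Matrix.of (g x)).det ≠ 0 := by
    have := congrArg Matrix.det (hm x hx)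
    rw [Matrix.det_mul, Matrix.det_one] at this
    exact left_ne_zero_of_mul_eq_one this
  have hev : (fun y => ginv y i j) =ᶠ[nhds x]
      fun y => ((Matrix.of (g y)).det)⁻¹ * (Matrix.of (g y)).adjugate i j := by
    filter_upwards [hU.mem_nhds hx] with y hy
    have h1 := Matrix.inv_eq_right_inv (hm y hy)
    have h2 := congrFun (congrFun h1 i) j
    rw [Matrix.inv_def, Matrix.smul_apply, Ring.inverse_eq_inv', smul_eq_mul] at h2
    exact h2.symm
  refine DifferentiableAt.congr_of_eventuallyEq ?_ hev
  refine ((det_diff _ fun a b => hg a b).fun_inv hdet).fun_mul ?_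
  simp only [Matrix.adjugate_apply]
  refine det_diff _ fun a b => ?_
  by_cases h : a = j
  · subst h
    simp
  · simpa [Matrix.updateRow_apply, h] using hg a b

lemma ginv_symm {U : Set Vec4} (g ginv : Vec4 → Fin 4 → Fin 4 → ℝ)
    (hsymm : ∀ x ∈ U, ∀ μ ν, g x μ ν = g x ν μ)
    (hinv : ∀ x ∈ U, ∀ μ ν, (∑ κ, g x μ κ * ginv x κ ν) = if μ = ν then 1 else 0)
    {x : Vec4} (hx : x ∈ U) (i j : Fin 4) : ginv x i j = ginv x j i := by
  have hm : (Matrix.of (g x)) * (Matrix.of (ginv x)) = 1 := by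
    ext a b
    rw [Matrix.mul_apply, Matrix.one_apply]
    exact hinv x hx a b
  have ht : (Matrix.of (g x)).transpose = Matrix.of (g x) := by
    ext a b
    exact hsymm x hx b a
  have h1 := Matrix.inv_eq_right_inv hm
  have h2 : (Matrix.of (ginv x)).transpose = Matrix.of (ginv x) := by
    rw [← h1, Matrix.transpose_nonsing_inv, ht]
  exact (congrFun (congrFun h2 j) i)

/-- Lowering the raised index returns the covector. -/
lemma lower_Vup {U : Set Vec4} (g ginv : Vec4 → Fin 4 → Fin 4 → ℝ)
    (hinv : ∀ x ∈ U, ∀ μ ν, (∑ κ, g x μ κ * ginv x κ ν) = if μ = ν then 1 else 0)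
    (V : Vec4 → Fin 4 → ℝ)
    {x : Vec4} (hx : x ∈ U) (i : Fin 4) : V x i = ∑ l, g x i l * Vup ginv V l x := by
  unfold Vup
  simp only [Finset.mul_sum]
  rw [Finset.sum_comm]
  have : ∀ ν, ∑ l, g x i l * (ginv x l ν * V x ν) = (if i = ν then 1 else 0) * V x ν := by
    intro ν
    rw [← hinv x hx i ν, Finset.sum_mul]
    exact Finset.sum_congr rfl fun _ _ => by ring
  simp [this]

lemma chris_symm {U : Set Vec4} (hU : IsOpen U) (g ginv : Vec4 → Fin 4 → Fin 4 → ℝ)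
    (hsymm : ∀ x ∈ U, ∀ μ ν, g x μ ν = g x ν μ)
    {x : Vec4} (hx : x ∈ U) (l μ ν : Fin 4) : Chris g ginv l μ ν x = Chris g ginv l ν μ x := by
  unfold Chris
  congr 1
  refine Finset.sum_congr rfl fun κ _ => ?_
  rw [pd_congr hU (fun y hy => hsymm y hy μ ν) hx κ]
  ring

/-- The Euler equation says that the contraction of the vorticity with the velocity vanishes. -/
lemma euler_contract
    (U : Set Vec4) (hU : IsOpen U)
    (g ginv : Vec4 → Fin 4 → Fin 4 → ℝ)
    (hsymm : ∀ x ∈ U, ∀ μ ν, g x μ ν = g x ν μ)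
    (hinv : ∀ x ∈ U, ∀ μ ν, (∑ κ, g x μ κ * ginv x κ ν) = if μ = ν then 1 else 0)
    (V : Vec4 → Fin 4 → ℝ) {x : Vec4} (hx : x ∈ U)
    (hg : ∀ μ ν, DifferentiableAt ℝ (fun y => g y μ ν) x)
    (hV : ∀ μ, DifferentiableAt ℝ (fun y => V y μ) x)
    (hA : ∀ l, DifferentiableAt ℝ (Vup ginv V l) x)
    (ν : Fin 4)
    (heuler :
      (∑ l, Vup ginv V l x * covD g ginv V l ν x) + (1 / 2) * pd ν (normSq ginv V) x = 0) :
    ∑ l, Vup ginv V l x * vort V l ν x = 0 := by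
  -- derivative of the norm
  have hN : pd ν (normSq ginv V) x
      = - ∑ l, (pd ν (Vup ginv V l) x * V x l + Vup ginv V l x * pd ν (fun y => V y l) x) := by
    rw [← pd_sum_mul ν (Vup ginv V) (fun l y => V y l) hA hV, ← pd_neg']
    congr 1
    funext y
    unfold normSq Vup
    rw [neg_inj]
    refine Finset.sum_congr rfl fun l _ => ?_
    rw [Finset.sum_mul]
    exact Finset.sum_congr rfl fun k _ => by ring
  have hdV : ∀ i, pd ν (fun y => V y i) x
      = ∑ l, (pd ν (fun y => g y i l) x * Vup ginv V l x + g x i l * pd ν (Vup ginv V l) x) := by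
    intro i
    rw [← pd_sum_mul ν (fun l y => g y i l) (Vup ginv V) (hg i) hA]
    exact pd_congr hU (fun y hy => lower_Vup g ginv hinv V hy i) hx ν
  -- contraction of the Christoffel symbols with V
  have hG : ∀ l, ∑ κ, Chris g ginv κ l ν x * V x κ = (1 / 2) * ∑ c, Vup ginv V c x *
      (pd l (fun y => g y c ν) x + pd ν (fun y => g y c l) x - pd c (fun y => g y l ν) x) := by
    intro l
    unfold Chris Vup
    simp only [Finset.mul_sum, Finset.sum_mul]
    rw [Finset.sum_comm]
    refine Finset.sum_congr rfl fun c _ => Finset.sum_congr rfl fun κ _ => ?_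
    rw [ginv_symm g ginv hsymm hinv hx κ c]
    ring
  have hdA : ∑ l, pd ν (Vup ginv V l) x * V x l = ∑ l, Vup ginv V l x * pd ν (fun y => V y l) x
      - ∑ l, ∑ c, Vup ginv V l x * Vup ginv V c x * pd ν (fun y => g y c l) x := by
    have e1 : ∀ l c, pd ν (fun y => g y c l) x = pd ν (fun y => g y l c) x := fun l c =>
      pd_congr hU (fun y hy => hsymm y hy c l) hx ν
    simp only [hdV, lower_Vup g ginv hinv V hx, Finset.mul_sum]
    rw [← Finset.sum_sub_distrib]
    simp only [← Finset.sum_sub_distrib]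
    rw [Finset.sum_comm]
    refine Finset.sum_congr rfl fun c _ => Finset.sum_congr rfl fun l _ => ?_
    rw [hsymm x hx l c, e1 c l]
    ring
  have hGG : ∑ l, Vup ginv V l x * ∑ κ, Chris g ginv κ l ν x * V x κ
      = (1 / 2) * ∑ l, ∑ c, Vup ginv V l x * Vup ginv V c x * pd ν (fun y => g y c l) x := by
    have e2 : ∑ l, ∑ c, Vup ginv V l x * Vup ginv V c x * pd l (fun y => g y c ν) x
        = ∑ l, ∑ c, Vup ginv V l x * Vup ginv V c x * pd c (fun y => g y l ν) x := by
      rw [Finset.sum_comm]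
      exact Finset.sum_congr rfl fun c _ => Finset.sum_congr rfl fun l _ => by ring
    have e3 : ∀ l, Vup ginv V l x * ∑ κ, Chris g ginv κ l ν x * V x κ
        = (1 / 2) * ∑ c, Vup ginv V l x * Vup ginv V c x * pd l (fun y => g y c ν) x
        + (1 / 2) * ∑ c, Vup ginv V l x * Vup ginv V c x * pd ν (fun y => g y c l) x
        - (1 / 2) * ∑ c, Vup ginv V l x * Vup ginv V c x * pd c (fun y => g y l ν) x := by
      intro l
      rw [hG]
      simp only [Finset.mul_sum]
      rw [← Finset.sum_add_distrib, ← Finset.sum_sub_distrib]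
      exact Finset.sum_congr rfl fun c _ => by ring
    simp only [e3]
    rw [Finset.sum_sub_distrib, Finset.sum_add_distrib, ← Finset.mul_sum, ← Finset.mul_sum,
      ← Finset.mul_sum, e2]
    ring
  rw [hN, Finset.sum_add_distrib, hdA] at heuler
  simp only [covD, mul_sub, Finset.sum_sub_distrib] at heuler
  rw [hGG] at heuler
  simp only [vort, mul_sub, Finset.sum_sub_distrib]
  linarith

/-- If V satisfies the relativistic Euler equation, then the vorticity satisfies the
transport equation ∇_V ω_{μν} + (∇_μ V^λ)ω_{λν} + (∇_ν V^λ)ω_{μλ} = 0 on U. -/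
theorem vorticity_transport
    (U : Set Vec4) (hU : IsOpen U)
    (g ginv : Vec4 → Fin 4 → Fin 4 → ℝ)
    (hsymm : ∀ x ∈ U, ∀ μ ν, g x μ ν = g x ν μ)
    (hinv : ∀ x ∈ U, ∀ μ ν, (∑ κ, g x μ κ * ginv x κ ν) = if μ = ν then 1 else 0)
    (hg : ∀ μ ν, ContDiffOn ℝ 1 (fun x => g x μ ν) U)
    (V : Vec4 → Fin 4 → ℝ)
    (hV : ∀ μ, ContDiffOn ℝ 2 (fun x => V x μ) U)
    (heuler : ∀ x ∈ U, ∀ ν,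
      (∑ l, Vup ginv V l x * covD g ginv V l ν x) + (1 / 2) * pd ν (normSq ginv V) x = 0) :
    ∀ x ∈ U, ∀ μ ν,
      (∑ l, Vup ginv V l x * covVort g ginv V l μ ν x)
        + (∑ l, covDup g ginv V μ l x * vort V l ν x)
        + (∑ l, covDup g ginv V ν l x * vort V μ l x) = 0 := by
  intro x hx μ ν
  have hV2 : ∀ y ∈ U, ∀ i, ContDiffAt ℝ 2 (fun y => V y i) y := fun y hy i =>
    (hV i).contDiffAt (hU.mem_nhds hy)
  have hV1 : ∀ y ∈ U, ∀ i, DifferentiableAt ℝ (fun y => V y i) y := fun y hy i =>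
    (hV2 y hy i).differentiableAt (by norm_num)
  have hg1 : ∀ y ∈ U, ∀ i j, DifferentiableAt ℝ (fun y => g y i j) y := fun y hy i j =>
    ((hg i j).contDiffAt (hU.mem_nhds hy)).differentiableAt (by norm_num)
  have hA : ∀ y ∈ U, ∀ l, DifferentiableAt ℝ (Vup ginv V l) y := by
    intro y hy l
    unfold Vup
    exact DifferentiableAt.fun_sum fun i _ =>
      (ginv_diff hU g ginv hinv hy (hg1 y hy) l i).fun_mul (hV1 y hy i)
  have hc : ∀ y ∈ U, ∀ β, ∑ l, Vup ginv V l y * vort V l β y = 0 := fun y hy β =>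
    euler_contract U hU g ginv hsymm hinv V hy (hg1 y hy) (hV1 y hy) (hA y hy) β (heuler y hy β)
  have hp : ∀ a b, DifferentiableAt ℝ (pd a (fun y => V y b)) x := fun a b =>
    pd_diff a _ (hV2 x hx b)
  have hw : ∀ a b, DifferentiableAt ℝ (vort V a b) x := fun a b => (hp a b).fun_sub (hp b a)
  have hdc : ∀ α β, ∑ l, (pd α (Vup ginv V l) x * vort V l β x
      + Vup ginv V l x * pd α (vort V l β) x) = 0 := by
    intro α β
    rw [← pd_sum_mul α (Vup ginv V) (fun l => vort V l β) (hA x hx) (fun l => hw l β),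
      pd_congr hU (fun y hy => hc y hy β) hx α]
    simp [pd]
  have hdw : ∀ l a b, pd l (vort V a b) x
      = pd l (pd a (fun y => V y b)) x - pd l (pd b (fun y => V y a)) x := fun l a b =>
    pd_sub' l _ _ (hp a b) (hp b a)
  have hcl : ∀ l, pd l (vort V μ ν) x = pd μ (vort V l ν) x - pd ν (vort V l μ) x := by
    intro l
    rw [hdw, hdw, hdw, pd_comm l μ _ (hV2 x hx ν), pd_comm l ν _ (hV2 x hx μ),
      pd_comm μ ν _ (hV2 x hx l)]
    ring
  have hanti : ∀ a b, vort V a b x = - vort V b a x := fun a b => by unfold vort; ring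
  have h1 := hdc μ ν
  have h2 := hdc ν μ
  rw [Finset.sum_add_distrib] at h1 h2
  have hch := fun l a b => chris_symm hU g ginv hsymm hx l a b
  have t1 : ∑ l, Vup ginv V l x * covVort g ginv V l μ ν x
      = ∑ l, Vup ginv V l x * pd μ (vort V l ν) x - ∑ l, Vup ginv V l x * pd ν (vort V l μ) x
        - ∑ l, ∑ κ, Chris g ginv l μ κ x * Vup ginv V κ x * vort V l ν x
        - ∑ l, ∑ κ, Chris g ginv l ν κ x * Vup ginv V κ x * vort V μ l x := by
    rw [Finset.sum_comm (f := fun l κ => Chris g ginv l μ κ x * Vup ginv V κ x * vort V l ν x),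
      Finset.sum_comm (f := fun l κ => Chris g ginv l ν κ x * Vup ginv V κ x * vort V μ l x)]
    rw [← Finset.sum_sub_distrib, ← Finset.sum_sub_distrib, ← Finset.sum_sub_distrib]
    refine Finset.sum_congr rfl fun l _ => ?_
    have e : covVort g ginv V l μ ν x = pd μ (vort V l ν) x - pd ν (vort V l μ) x
      - (∑ κ, Chris g ginv κ l μ x * vort V κ ν x)
      - ∑ κ, Chris g ginv κ l ν x * vort V μ κ x := by rw [← hcl]; rfl
    rw [e, mul_sub, mul_sub, mul_sub, Finset.mul_sum, Finset.mul_sum]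
    congr 1
    · congr 1
      exact Finset.sum_congr rfl fun κ _ => by rw [hch κ l μ]; ring
    · exact Finset.sum_congr rfl fun κ _ => by rw [hch κ l ν]; ring
  have t2 : ∑ l, covDup g ginv V μ l x * vort V l ν x = ∑ l, pd μ (Vup ginv V l) x * vort V l ν x
      + ∑ l, ∑ κ, Chris g ginv l μ κ x * Vup ginv V κ x * vort V l ν x := by
    rw [← Finset.sum_add_distrib]
    refine Finset.sum_congr rfl fun l _ => ?_
    rw [← Finset.sum_mul, ← add_mul]
    rfl
  have t3 : ∑ l, covDup g ginv V ν l x * vort V μ l x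
      = - ∑ l, pd ν (Vup ginv V l) x * vort V l μ x
      + ∑ l, ∑ κ, Chris g ginv l ν κ x * Vup ginv V κ x * vort V μ l x := by
    rw [← Finset.sum_neg_distrib, ← Finset.sum_add_distrib]
    refine Finset.sum_congr rfl fun l _ => ?_
    rw [← Finset.sum_mul, hanti l μ, mul_neg, neg_neg, ← add_mul]
    rfl
  rw [t1, t2, t3]
  linarith
end
end

section
/- Assume the frame hypotheses: (H1) Θ̂^K e_K^μ = δ₀^μ on U for every μ; (H2) torsion-free compatibility: Γ_{IJ}^K e_K^μ − Γ_{JI}^K e_K^μ = D_I e_J^μ − D_J e_I^μ on U for all I, J, μ; (H3) parallel transport: Θ̂^J Γ_{JI}^K = 0 on U for all I, K. Then the frame components satisfy the transport equations ∂_t e_Ĩ^μ = −(D_Ĩ Θ̂^J) e_J^μ − Θ̂^J Γ_{ĨJ}^K e_K^μ on U for Ĩ = 1,2,3 and every μ. Moreover, at every point where Θ̂⁰ ≠ 0 one has e_0^μ = (δ₀^μ − Θ̂^Ĩ e_Ĩ^μ)/Θ̂⁰. -/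
noncomputable section

/-- Frame derivative D_I f := e_I^μ ∂_μ f. -/
def DI (e : Fin 4 → Vec4 → Fin 4 → ℝ) (I : Fin 4) (f : Vec4 → ℝ) (x : Vec4) : ℝ :=
  ∑ μ, e I x μ * pd μ f x

/-- The transport system (1.19) for the frame elements:
∂_t e_Ĩ^μ = −(D_Ĩ Θ̂^J)e_J^μ − Θ̂^J Γ_{ĨJ}^K e_K^μ for Ĩ = 1,2,3, and
e_0^μ = (δ₀^μ − Θ̂^Ĩ e_Ĩ^μ)/Θ̂⁰ where Θ̂⁰ ≠ 0, under the frame hypotheses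
(H1) Θ̂^K e_K^μ = δ₀^μ, (H2) torsion-free compatibility, (H3) Θ̂^J Γ_{JI}^K = 0. -/
theorem frame_transport_equations
    (U : Set Vec4) (hU : IsOpen U)
    (e : Fin 4 → Vec4 → Fin 4 → ℝ)
    (Θ : Fin 4 → Vec4 → ℝ)
    (Γc : Fin 4 → Fin 4 → Fin 4 → Vec4 → ℝ)
    (he : ∀ I μ, ContDiffOn ℝ 1 (fun x => e I x μ) U)
    (hΘ : ∀ I, ContDiffOn ℝ 1 (Θ I) U)
    (H1 : ∀ x ∈ U, ∀ μ, (∑ K, Θ K x * e K x μ) = if μ = 0 then 1 else 0)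
    (H2 : ∀ x ∈ U, ∀ I J μ,
      (∑ K, Γc I J K x * e K x μ) - (∑ K, Γc J I K x * e K x μ)
        = DI e I (fun y => e J y μ) x - DI e J (fun y => e I y μ) x)
    (H3 : ∀ x ∈ U, ∀ I K, (∑ J, Θ J x * Γc J I K x) = 0) :
    (∀ x ∈ U, ∀ It ∈ ({1, 2, 3} : Finset (Fin 4)), ∀ μ,
      pd 0 (fun y => e It y μ) x
        = -(∑ J, DI e It (Θ J) x * e J x μ) - ∑ J, ∑ K, Θ J x * Γc It J K x * e K x μ)
    ∧
    (∀ x ∈ U, Θ 0 x ≠ 0 → ∀ μ,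
      e 0 x μ = ((if μ = 0 then 1 else 0)
        - ∑ It ∈ ({1, 2, 3} : Finset (Fin 4)), Θ It x * e It x μ) / Θ 0 x) := by
  refine ⟨?_, ?_⟩
  · intro x hx It _ μ
    have hxU : U ∈ nhds x := hU.mem_nhds hx
    have dΘ : ∀ K, DifferentiableAt ℝ (Θ K) x := fun K =>
      ((hΘ K).contDiffAt hxU).differentiableAt (by norm_num)
    have de : ∀ K, DifferentiableAt ℝ (fun y => e K y μ) x := fun K =>
      ((he K μ).contDiffAt hxU).differentiableAt (by norm_num)
    -- differentiate (H1)
    have hpd : ∀ ν, ∑ K, (Θ K x * pd ν (fun y => e K y μ) x + e K x μ * pd ν (Θ K) x) = 0 := by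
      intro ν
      have h1 : HasFDerivAt (fun y => ∑ K, Θ K y * e K y μ)
          (∑ K, (Θ K x • fderiv ℝ (fun y => e K y μ) x + e K x μ • fderiv ℝ (Θ K) x)) x :=
        HasFDerivAt.fun_sum fun K _ => (dΘ K).hasFDerivAt.mul (de K).hasFDerivAt
      have h2 : HasFDerivAt (fun y => ∑ K, Θ K y * e K y μ) (0 : Vec4 →L[ℝ] ℝ) x := by
        refine (hasFDerivAt_const (if μ = 0 then (1 : ℝ) else 0) x).congr_of_eventuallyEq ?_
        filter_upwards [hxU] with y hy using H1 y hy μ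
      have h3 := congrArg (fun L : Vec4 →L[ℝ] ℝ => L (Pi.single ν 1)) (h1.unique h2)
      simpa [pd, ContinuousLinearMap.sum_apply] using h3
    have hD : ∑ K, Θ K x * DI e It (fun y => e K y μ) x + ∑ K, DI e It (Θ K) x * e K x μ = 0 := by
      have h : ∑ ν, e It x ν *
          ∑ K, (Θ K x * pd ν (fun y => e K y μ) x + e K x μ * pd ν (Θ K) x) = 0 := by
        simp [hpd]
      rw [← h]
      simp only [DI, Finset.mul_sum, Finset.sum_mul]
      simp only [← Finset.sum_add_distrib]
      rw [Finset.sum_comm]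
      refine Finset.sum_congr rfl fun K _ => Finset.sum_congr rfl fun ν _ => ?_
      ring
    have ht : pd 0 (fun y => e It y μ) x = ∑ K, Θ K x * DI e K (fun y => e It y μ) x := by
      simp only [DI, Finset.mul_sum]
      rw [Finset.sum_comm]
      simp only [← mul_assoc, ← Finset.sum_mul, H1 x hx]
      simp
    have hG : ∑ K, Θ K x * ∑ L, Γc K It L x * e L x μ = 0 := by
      simp only [Finset.mul_sum]
      rw [Finset.sum_comm]
      simp only [← mul_assoc, ← Finset.sum_mul, H3 x hx]
      simp
    have hS : ∑ K, Θ K x * ((∑ L, Γc It K L x * e L x μ) - (∑ L, Γc K It L x * e L x μ))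
        = ∑ K, Θ K x * (DI e It (fun y => e K y μ) x - DI e K (fun y => e It y μ) x) :=
      Finset.sum_congr rfl fun K _ => by rw [H2 x hx It K μ]
    simp only [mul_sub, Finset.sum_sub_distrib] at hS
    have hR : ∑ J, ∑ K, Θ J x * Γc It J K x * e K x μ
        = ∑ K, Θ K x * ∑ L, Γc It K L x * e L x μ := by
      simp only [Finset.mul_sum, mul_assoc]
    rw [ht, hR]
    linarith
  · intro x hx h0 μ
    have h := H1 x hx μ
    rw [Fin.sum_univ_four] at h
    rw [eq_div_iff h0, ← h]
    have : ∑ It ∈ ({1, 2, 3} : Finset (Fin 4)), Θ It x * e It x μ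
        = Θ 1 x * e 1 x μ + (Θ 2 x * e 2 x μ + Θ 3 x * e 3 x μ) := by
      rw [Finset.sum_insert (by decide), Finset.sum_insert (by decide), Finset.sum_singleton]
    rw [this]
    ring
end
end

section
/- Assume: (H1) Θ̂^K e_K^μ = δ₀^μ on U for every μ; (H3) Θ̂^J Γ_{JI}^K = 0 on U for all I, K, with Γ_{IJ}^K of class C¹; and suppose the functions R^K{}_{MIJ} : U → ℝ satisfy the frame curvature relation R^K{}_{MIJ} = D_I Γ_{JM}^K − D_J Γ_{IM}^K + Γ_{IL}^K Γ_{JM}^L − Γ_{JL}^K Γ_{IM}^L + (Γ_{JI}^L − Γ_{IJ}^L) Γ_{LM}^K on U for all indices. Then the connection coefficients satisfy the transport equations ∂_t Γ_{ĨJ}^K = Θ̂^I( R^K{}_{JIĨ} − Γ_{LJ}^K Γ_{ĨI}^L ) − Γ_{IJ}^K D_Ĩ Θ̂^I on U for Ĩ = 1,2,3 and all J, K. Moreover, at every point where Θ̂⁰ ≠ 0 one has Γ_{0J}^K = −(Θ̂^Ĩ/Θ̂⁰) Γ_{ĨJ}^K. -/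
noncomputable section

/-- The transport system (1.20) for the connection coefficients:
∂_t Γ_{ĨJ}^K = Θ̂^I(R^K{}_{JIĨ} − Γ_{LJ}^K Γ_{ĨI}^L) − Γ_{IJ}^K D_Ĩ Θ̂^I for Ĩ = 1,2,3,
and Γ_{0J}^K = −(Θ̂^Ĩ/Θ̂⁰)Γ_{ĨJ}^K where Θ̂⁰ ≠ 0, under (H1) Θ̂^K e_K^μ = δ₀^μ,
(H3) Θ̂^J Γ_{JI}^K = 0 and the frame curvature (structure) relation. -/
theorem connection_transport_equations
    (U : Set Vec4) (hU : IsOpen U)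
    (e : Fin 4 → Vec4 → Fin 4 → ℝ)
    (Θ : Fin 4 → Vec4 → ℝ)
    (Γc : Fin 4 → Fin 4 → Fin 4 → Vec4 → ℝ)
    (R : Fin 4 → Fin 4 → Fin 4 → Fin 4 → Vec4 → ℝ)
    (he : ∀ I μ, ContDiffOn ℝ 1 (fun x => e I x μ) U)
    (hΘ : ∀ I, ContDiffOn ℝ 1 (Θ I) U)
    (hΓ : ∀ I J K, ContDiffOn ℝ 1 (Γc I J K) U)
    (H1 : ∀ x ∈ U, ∀ μ, (∑ K, Θ K x * e K x μ) = if μ = 0 then 1 else 0)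
    (H3 : ∀ x ∈ U, ∀ I K, (∑ J, Θ J x * Γc J I K x) = 0)
    (hR : ∀ x ∈ U, ∀ K M I J,
      R K M I J x
        = DI e I (Γc J M K) x - DI e J (Γc I M K) x
          + (∑ L, Γc I L K x * Γc J M L x) - (∑ L, Γc J L K x * Γc I M L x)
          + ∑ L, (Γc J I L x - Γc I J L x) * Γc L M K x) :
    (∀ x ∈ U, ∀ It ∈ ({1, 2, 3} : Finset (Fin 4)), ∀ J K,
      pd 0 (Γc It J K) x
        = (∑ I, Θ I x * (R K J I It x - ∑ L, Γc L J K x * Γc It I L x))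
          - ∑ I, Γc I J K x * DI e It (Θ I) x)
    ∧
    (∀ x ∈ U, Θ 0 x ≠ 0 → ∀ J K,
      Γc 0 J K x
        = -∑ It ∈ ({1, 2, 3} : Finset (Fin 4)), (Θ It x / Θ 0 x) * Γc It J K x) := by
  refine ⟨?_, ?_⟩
  · intro x hx It _ J K
    have hnhds : U ∈ nhds x := hU.mem_nhds hx
    have dΘ : ∀ I, DifferentiableAt ℝ (Θ I) x := fun I =>
      ((hΘ I).contDiffAt hnhds).differentiableAt (by norm_num)
    have dΓ : ∀ I, DifferentiableAt ℝ (Γc I J K) x := fun I =>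
      ((hΓ I J K).contDiffAt hnhds).differentiableAt (by norm_num)
    -- the frame derivative along Θ is the time derivative
    have A : ∑ I, Θ I x * DI e I (Γc It J K) x = pd 0 (Γc It J K) x := by
      have h0 := H1 x hx 0
      have h1 := H1 x hx 1
      have h2 := H1 x hx 2
      have h3 := H1 x hx 3
      simp [Fin.sum_univ_four] at h0 h1 h2 h3
      simp only [DI, Fin.sum_univ_four]
      linear_combination pd 0 (Γc It J K) x * h0 + pd 1 (Γc It J K) x * h1
        + pd 2 (Γc It J K) x * h2 + pd 3 (Γc It J K) x * h3
    -- differentiating the gauge condition (H3)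
    have P : ∀ μ, ∑ I, (Θ I x * pd μ (Γc I J K) x + Γc I J K x * pd μ (Θ I) x) = 0 := by
      intro μ
      have hd : HasFDerivAt (fun y => ∑ I, Θ I y * Γc I J K y)
          (∑ I, (Θ I x • fderiv ℝ (Γc I J K) x + Γc I J K x • fderiv ℝ (Θ I) x)) x :=
        HasFDerivAt.fun_sum fun I _ => (dΘ I).hasFDerivAt.mul (dΓ I).hasFDerivAt
      have hz : HasFDerivAt (fun y => ∑ I, Θ I y * Γc I J K y) (0 : Vec4 →L[ℝ] ℝ) x := by
        refine (hasFDerivAt_const (0 : ℝ) x).congr_of_eventuallyEq ?_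
        filter_upwards [hnhds] with y hy using H3 y hy J K
      have := congrArg (fun L : Vec4 →L[ℝ] ℝ => L (Pi.single μ 1)) (hd.unique hz)
      simpa [pd] using this
    have B : ∑ I, Θ I x * DI e It (Γc I J K) x + ∑ I, Γc I J K x * DI e It (Θ I) x = 0 := by
      have h0 := P 0
      have h1 := P 1
      have h2 := P 2
      have h3 := P 3
      simp only [DI, Fin.sum_univ_four] at h0 h1 h2 h3 ⊢
      linear_combination e It x 0 * h0 + e It x 1 * h1 + e It x 2 * h2 + e It x 3 * h3
    have C : ∀ M N, _ := fun M N => H3 x hx M N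
    simp only [hR x hx]
    simp only [Fin.sum_univ_four] at A B C ⊢
    linear_combination -A + B
      - (C 0 K * Γc It J 0 x + C 1 K * Γc It J 1 x + C 2 K * Γc It J 2 x + C 3 K * Γc It J 3 x)
      + (C J 0 * Γc It 0 K x + C J 1 * Γc It 1 K x + C J 2 * Γc It 2 K x + C J 3 * Γc It 3 K x)
      + (C It 0 * Γc 0 J K x + C It 1 * Γc 1 J K x + C It 2 * Γc 2 J K x + C It 3 * Γc 3 J K x)
  · intro x hx h0 J K
    have h := H3 x hx J K
    have hs : ∑ It ∈ ({1, 2, 3} : Finset (Fin 4)), (Θ It x / Θ 0 x) * Γc It J K x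
        = Θ 1 x / Θ 0 x * Γc 1 J K x + (Θ 2 x / Θ 0 x * Γc 2 J K x
          + Θ 3 x / Θ 0 x * Γc 3 J K x) := by
      rw [Finset.sum_insert (by decide), Finset.sum_insert (by decide), Finset.sum_singleton]
    rw [hs]
    rw [Fin.sum_univ_four] at h
    field_simp
    linear_combination h
end
end
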